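/- Let d₁, d₂ be odd positive integers with d₁ ∣ d₂ and D = diag(d₁,d₂). Let q₀(x₁,x₂,x₃,x₄) = x₁x₃ + x₂x₄ be the even quadratic form on 𝔽₂⁴, and define Γ₂(d₁,d₂)⁺ = {Z ∈ Γ_D(D) : the entrywise mod-2 reduction Z̄ of Z satisfies q₀(Z̄x) = q₀(x) for all x ∈ 𝔽₂⁴}. Then Γ₂(d₁,d₂)⁺ is a subgroup of Γ_D(D) of index 10. -/

import Mathlib

open Matrix

/-- The matrix `J_D = [[0, D], [−D, 0]]` over `ℤ`, for `D = diag(d₁,d₂)`. -/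
def JD (d1 d2 : ℤ) : Matrix (Fin 4) (Fin 4) ℤ :=
  !![0, 0, d1, 0; 0, 0, 0, d2; -d1, 0, 0, 0; 0, -d2, 0, 0]

/-- The vector `(d₁, d₂, d₁, d₂)` of row divisibilities. -/
def dvec (d1 d2 : ℤ) : Fin 4 → ℤ := ![d1, d2, d1, d2]

/-- Membership in `Γ_D(D)`: `M·J_D·Mᵀ = J_D` and each block of `M − I₄` is of the form
`D·Y`, i.e. rows `0,2` of `M − I₄` are divisible by `d₁` and rows `1,3` by `d₂`. -/
def InGammaDD (d1 d2 : ℤ) (M : Matrix (Fin 4) (Fin 4) ℤ) : Prop :=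
  M * JD d1 d2 * Mᵀ = JD d1 d2 ∧ ∀ i j, dvec d1 d2 i ∣ (M - 1) i j

/-- Entrywise reduction modulo 2 of an integer matrix. -/
def red2 (M : Matrix (Fin 4) (Fin 4) ℤ) : Matrix (Fin 4) (Fin 4) (ZMod 2) :=
  M.map (Int.cast)

/-- The even quadratic form `q₀(x₁,x₂,x₃,x₄) = x₁x₃ + x₂x₄` on `𝔽₂⁴`
(0-based indices). -/
def q0 (x : Fin 4 → ZMod 2) : ZMod 2 :=
  x 0 * x 2 + x 1 * x 3

lemma red2_mul (A B : Matrix (Fin 4) (Fin 4) ℤ) : red2 (A * B) = red2 A * red2 B :=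
  map_mul (Int.castRingHom (ZMod 2)).mapMatrix A B

lemma red2_one : red2 1 = 1 := map_one (Int.castRingHom (ZMod 2)).mapMatrix

/-- The action of invertible integer matrices on functions on `𝔽₂⁴`. -/
@[reducible] def actF : MulAction (Matrix (Fin 4) (Fin 4) ℤ)ˣ ((Fin 4 → ZMod 2) → ZMod 2) where
  smul R f := fun x => f ((red2 ((R⁻¹ : (Matrix (Fin 4) (Fin 4) ℤ)ˣ) : Matrix (Fin 4) (Fin 4) ℤ)).mulVec x)
  one_smul f := by
    funext x
    change f _ = f x
    simp [red2_one]
  mul_smul R S f := by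
    funext x
    change f _ = f _
    rw [_root_.mul_inv_rev, Units.val_mul, red2_mul, Matrix.mulVec_mulVec]

lemma inG_one (d1 d2 : ℤ) : InGammaDD d1 d2 1 := by
  constructor
  · simp
  · intro i j
    simp

lemma inG_mul (d1 d2 : ℤ) {A B : Matrix (Fin 4) (Fin 4) ℤ}
    (hA : InGammaDD d1 d2 A) (hB : InGammaDD d1 d2 B) : InGammaDD d1 d2 (A * B) := by
  constructor
  · rw [Matrix.transpose_mul]
    calc A * B * JD d1 d2 * (Bᵀ * Aᵀ) = A * (B * JD d1 d2 * Bᵀ) * Aᵀ := by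
          simp only [Matrix.mul_assoc]
      _ = _ := by rw [hB.1, hA.1]
  · intro i j
    have h : A * B - 1 = (A - 1) * B + (B - 1) := by noncomm_ring
    rw [h, Matrix.add_apply, Matrix.mul_apply]
    exact dvd_add (Finset.dvd_sum fun k _ => Dvd.dvd.mul_right (hA.2 i k) _) (hB.2 i j)

lemma inG_inv (d1 d2 : ℤ) {A B : Matrix (Fin 4) (Fin 4) ℤ} (hBA : B * A = 1) (hAB : A * B = 1)
    (hA : InGammaDD d1 d2 A) : InGammaDD d1 d2 B := by
  constructor
  · have ht : Aᵀ * Bᵀ = 1 := by rw [← Matrix.transpose_mul, hBA, Matrix.transpose_one]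
    calc B * JD d1 d2 * Bᵀ = B * (A * JD d1 d2 * Aᵀ) * Bᵀ := by rw [hA.1]
      _ = (B * A) * JD d1 d2 * (Aᵀ * Bᵀ) := by simp only [Matrix.mul_assoc]
      _ = _ := by rw [hBA, ht, Matrix.one_mul, Matrix.mul_one]
  · intro i j
    have h : B - 1 = (A - 1) * (-B) := by
      rw [Matrix.sub_mul, Matrix.mul_neg, hAB, Matrix.one_mul]; abel
    rw [h, Matrix.mul_apply]
    exact Finset.dvd_sum fun k _ => Dvd.dvd.mul_right (hA.2 i k) _

/-- The group `Γ_D(D)`. -/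
def GG (d1 d2 : ℤ) : Subgroup (Matrix (Fin 4) (Fin 4) ℤ)ˣ where
  carrier := {R | InGammaDD d1 d2 (R : Matrix (Fin 4) (Fin 4) ℤ)}
  one_mem' := inG_one d1 d2
  mul_mem' := fun ha hb => inG_mul d1 d2 ha hb
  inv_mem' := fun {a} ha => inG_inv d1 d2 a.inv_mul a.mul_inv ha

/-- The transvection `1 + k·(D̃u)(J⁻¹u)ᵀ`. -/
def tv (d1 d2 k : ℤ) (u : Fin 4 → ℤ) : Matrix (Fin 4) (Fin 4) ℤ :=
  1 + Matrix.vecMulVec ![k * d1 * u 0, k * d2 * u 1, k * d1 * u 2, k * d2 * u 3]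
    ![-u 2, -u 3, u 0, u 1]

lemma tv_mul (d1 d2 : ℤ) (u : Fin 4 → ℤ) (k : ℤ) : tv d1 d2 k u * tv d1 d2 (-k) u = 1 := by
  ext i j
  fin_cases i <;> fin_cases j <;>
    simp [tv, Matrix.mul_apply, Fin.sum_univ_four, Matrix.vecMulVec_apply, Matrix.one_apply] <;> ring

lemma tv_mem (d1 d2 : ℤ) (u : Fin 4 → ℤ) (k : ℤ) : InGammaDD d1 d2 (tv d1 d2 k u) := by
  constructor
  · ext i j
    fin_cases i <;> fin_cases j <;>
      simp [tv, JD, Matrix.mul_apply, Fin.sum_univ_four, Matrix.vecMulVec_apply,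
        Matrix.one_apply] <;> ring
  · intro i j
    have : tv d1 d2 k u - 1 = Matrix.vecMulVec ![k * d1 * u 0, k * d2 * u 1, k * d1 * u 2, k * d2 * u 3]
      ![-u 2, -u 3, u 0, u 1] := by simp [tv]
    rw [this, Matrix.vecMulVec_apply]
    apply Dvd.dvd.mul_right
    fin_cases i <;> simp only [dvec] <;>
      exact Dvd.dvd.mul_right (Dvd.intro_left k rfl) _

/-- The transvection as a unit. -/
def tvU (d1 d2 : ℤ) (u : Fin 4 → ℤ) : (Matrix (Fin 4) (Fin 4) ℤ)ˣ where
  val := tv d1 d2 (-1) u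
  inv := tv d1 d2 1 u
  val_inv := by simpa using tv_mul d1 d2 u (-1)
  inv_val := tv_mul d1 d2 u 1

lemma tvU_mem (d1 d2 : ℤ) (u : Fin 4 → ℤ) : tvU d1 d2 u ∈ GG d1 d2 := by
  change InGammaDD d1 d2 (tv d1 d2 (-1) u)
  exact tv_mem d1 d2 u (-1)

lemma tvU_inv (d1 d2 : ℤ) (u : Fin 4 → ℤ) :
    (((tvU d1 d2 u)⁻¹ : (Matrix (Fin 4) (Fin 4) ℤ)ˣ) : Matrix (Fin 4) (Fin 4) ℤ) = tv d1 d2 1 u :=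
  rfl

/-- The symplectic form. -/
def BB (x y : Fin 4 → ZMod 2) : ZMod 2 := x 0 * y 2 + x 2 * y 0 + x 1 * y 3 + x 3 * y 1

lemma scalar_id : ∀ a b c e x y z w : ZMod 2, a * c + b * e = 0 →
    (x + a * (-c * x + -e * y + a * z + b * w)) * (z + c * (-c * x + -e * y + a * z + b * w)) +
    (y + b * (-c * x + -e * y + a * z + b * w)) * (w + e * (-c * x + -e * y + a * z + b * w)) =
    x * z + y * w + (a * z + c * x + b * w + e * y) := by
  decide

lemma q0_tv (d1 d2 : ℤ) (h1 : Odd d1) (h2 : Odd d2) (u x : Fin 4 → ZMod 2) (hu : q0 u = 0) :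
    q0 ((red2 (tv d1 d2 1 (fun i => ((u i).val : ℤ)))).mulVec x) = q0 x + BB u x := by
  have e1 : (d1 : ZMod 2) = 1 := by
    obtain ⟨k, rfl⟩ := h1
    push_cast
    rw [show (2 : ZMod 2) = 0 from rfl]; simp
  have e2 : (d2 : ZMod 2) = 1 := by
    obtain ⟨k, rfl⟩ := h2
    push_cast
    rw [show (2 : ZMod 2) = 0 from rfl]; simp
  have hc : ∀ i, (((u i).val : ℤ) : ZMod 2) = u i := fun i => by simp
  have key : (red2 (tv d1 d2 1 (fun i => ((u i).val : ℤ)))).mulVec x =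
      fun i => x i + u i * (-u 2 * x 0 + -u 3 * x 1 + u 0 * x 2 + u 1 * x 3) := by
    funext i
    fin_cases i <;>
      simp [red2, tv, Matrix.mulVec, dotProduct, Fin.sum_univ_four, Matrix.vecMulVec_apply,
        Matrix.one_apply, e1, e2] <;> ring
  rw [key]
  exact scalar_id _ _ _ _ _ _ _ _ hu

lemma q0_add (x y : Fin 4 → ZMod 2) : q0 (x + y) = q0 x + q0 y + BB x y := by
  simp only [q0, BB, Pi.add_apply]; ring

/-- The symplectic Gram matrix modulo 2. -/
def J2 : Matrix (Fin 4) (Fin 4) (ZMod 2) := !![0, 0, 1, 0; 0, 0, 0, 1; 1, 0, 0, 0; 0, 1, 0, 0]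

lemma J2_sq : J2 * J2 = 1 := by decide

lemma BB_eq (x y : Fin 4 → ZMod 2) : BB x y = x ⬝ᵥ (J2.mulVec y) := by
  simp [BB, J2, Matrix.mulVec, dotProduct, Fin.sum_univ_four]; ring

lemma red2_sympl (d1 d2 : ℤ) (h1 : Odd d1) (h2 : Odd d2) {A : Matrix (Fin 4) (Fin 4) ℤ}
    (hA : InGammaDD d1 d2 A) : (red2 A)ᵀ * J2 * red2 A = J2 := by
  have e1 : (d1 : ZMod 2) = 1 := by
    obtain ⟨k, rfl⟩ := h1
    push_cast
    rw [show (2 : ZMod 2) = 0 from rfl]; simp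
  have e2 : (d2 : ZMod 2) = 1 := by
    obtain ⟨k, rfl⟩ := h2
    push_cast
    rw [show (2 : ZMod 2) = 0 from rfl]; simp
  have hJ : red2 (JD d1 d2) = J2 := by
    ext i j
    fin_cases i <;> fin_cases j <;> simp [red2, JD, J2, e1, e2]
  have h := congrArg red2 hA.1
  have ht : red2 Aᵀ = (red2 A)ᵀ := rfl
  rw [red2_mul, red2_mul, hJ, ht] at h
  have h' : red2 A * (J2 * (red2 A)ᵀ * J2) = 1 := by
    calc red2 A * (J2 * (red2 A)ᵀ * J2) = (red2 A * J2 * (red2 A)ᵀ) * J2 := by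
          simp only [Matrix.mul_assoc]
      _ = 1 := by rw [h, J2_sq]
  rw [mul_eq_one_comm] at h'
  calc (red2 A)ᵀ * J2 * red2 A = (J2 * J2) * ((red2 A)ᵀ * J2 * red2 A) := by
        rw [J2_sq, Matrix.one_mul]
    _ = J2 * (J2 * (red2 A)ᵀ * J2 * red2 A) := by simp only [Matrix.mul_assoc]
    _ = J2 := by rw [h', Matrix.mul_one]

lemma BB_inv {S : Matrix (Fin 4) (Fin 4) (ZMod 2)} (hS : Sᵀ * J2 * S = J2)
    (x y : Fin 4 → ZMod 2) : BB (S.mulVec x) (S.mulVec y) = BB x y := by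
  rw [BB_eq, BB_eq, ← Matrix.vecMul_transpose, ← Matrix.dotProduct_mulVec,
    Matrix.mulVec_mulVec, Matrix.mulVec_mulVec, hS]

lemma lin_rep (g : (Fin 4 → ZMod 2) → ZMod 2) (hg : ∀ x y, g (x + y) = g x + g y) :
    ∃ a, ∀ x, g x = BB a x := by
  let f : (Fin 4 → ZMod 2) →ₗ[ZMod 2] ZMod 2 := (AddMonoidHom.mk' g hg).toZModLinearMap 2
  refine ⟨![f (Pi.single 2 1), f (Pi.single 3 1), f (Pi.single 0 1), f (Pi.single 1 1)], fun x => ?_⟩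
  have h : f x = ∑ i, x i * f (Pi.single i 1) := by
    conv_lhs => rw [pi_eq_sum_univ' x]
    simp [map_sum]
  change f x = _
  rw [h]
  simp [BB, Fin.sum_univ_four]; ring

lemma arf_count : ∀ a : Fin 4 → ZMod 2,
    (Finset.univ.filter fun x : Fin 4 → ZMod 2 => q0 x + BB a x = 0).card = 10 → q0 a = 0 := by
  decide +kernel

lemma zeros_count : (Finset.univ.filter fun x : Fin 4 → ZMod 2 => q0 x = 0).card = 10 := by
  decide +kernel

lemma BB_inj {a b : Fin 4 → ZMod 2} (h : ∀ x, BB a x = BB b x) : a = b := by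
  funext i
  have h0 := h ![1, 0, 0, 0]
  have h1 := h ![0, 1, 0, 0]
  have h2 := h ![0, 0, 1, 0]
  have h3 := h ![0, 0, 0, 1]
  simp [BB] at h0 h1 h2 h3
  fin_cases i <;> simpa

lemma orbit_form {S T : Matrix (Fin 4) (Fin 4) (ZMod 2)} (hS : Sᵀ * J2 * S = J2)
    (hTS : T * S = 1) (hST : S * T = 1) :
    ∃ a, q0 a = 0 ∧ ∀ x, q0 (S.mulVec x) = q0 x + BB a x := by
  obtain ⟨a, ha⟩ := lin_rep (fun x => q0 (S.mulVec x) - q0 x) (fun x y => by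
    simp only [Matrix.mulVec_add, q0_add, BB_inv hS]; ring)
  have ha' : ∀ x, q0 (S.mulVec x) = q0 x + BB a x := fun x => by rw [← ha x]; ring
  refine ⟨a, arf_count a ?_, ha'⟩
  rw [← zeros_count]
  refine Finset.card_bij (fun x _ => S.mulVec x) ?_ ?_ ?_
  · intro x hx
    simpa [ha'] using hx
  · intro x _ y _ hxy
    have := congrArg T.mulVec hxy
    simpa [Matrix.mulVec_mulVec, hTS] using this
  · intro y hy
    have hy' : S.mulVec (T.mulVec y) = y := by simp [Matrix.mulVec_mulVec, hST]
    refine ⟨T.mulVec y, ?_, hy'⟩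
    rw [Finset.mem_filter, ← ha', hy']
    simpa using hy

/-- For odd positive `d₁ ∣ d₂`, the set `Γ₂(d₁,d₂)⁺` of elements of `Γ_D(D)` whose mod-2
reduction preserves the even quadratic form `q₀` is a subgroup of `Γ_D(D)` of index 10.
(Elements of `Γ_D(D)` are units of the matrix ring, and both sets are subgroups of the
unit group.) -/
theorem statement12 (d1 d2 : ℤ) (h1 : Odd d1) (h1p : 0 < d1) (h2 : Odd d2) (h2p : 0 < d2)
    (hdvd : d1 ∣ d2) :
    ∃ G H : Subgroup (Matrix (Fin 4) (Fin 4) ℤ)ˣ,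
      (G : Set (Matrix (Fin 4) (Fin 4) ℤ)ˣ) =
        {R : (Matrix (Fin 4) (Fin 4) ℤ)ˣ | InGammaDD d1 d2 (R : Matrix (Fin 4) (Fin 4) ℤ)} ∧
      (H : Set (Matrix (Fin 4) (Fin 4) ℤ)ˣ) =
        {R : (Matrix (Fin 4) (Fin 4) ℤ)ˣ | InGammaDD d1 d2 (R : Matrix (Fin 4) (Fin 4) ℤ) ∧
          ∀ x : Fin 4 → ZMod 2,
            q0 ((red2 (R : Matrix (Fin 4) (Fin 4) ℤ)).mulVec x) = q0 x} ∧
      H ≤ G ∧ H.relIndex G = 10 := by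
  letI := actF
  have smul_def : ∀ (R : (Matrix (Fin 4) (Fin 4) ℤ)ˣ) (f : (Fin 4 → ZMod 2) → ZMod 2) x,
      (R • f) x = f ((red2 ((R⁻¹ : (Matrix (Fin 4) (Fin 4) ℤ)ˣ) :
        Matrix (Fin 4) (Fin 4) ℤ)).mulVec x) := fun _ _ _ => rfl
  refine ⟨GG d1 d2, GG d1 d2 ⊓ MulAction.stabilizer _ q0, rfl, ?_, inf_le_left, ?_⟩
  · ext R
    change R ∈ GG d1 d2 ∧ R ∈ MulAction.stabilizer _ q0 ↔ R ∈ GG d1 d2 ∧ _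
    refine and_congr_right fun _ => ?_
    rw [← inv_mem_iff, MulAction.mem_stabilizer_iff, funext_iff]
    simp only [smul_def, inv_inv]
  · rw [inf_comm, Subgroup.inf_relIndex_right]
    have hst : (MulAction.stabilizer (Matrix (Fin 4) (Fin 4) ℤ)ˣ q0).subgroupOf (GG d1 d2) =
        MulAction.stabilizer (GG d1 d2) q0 := rfl
    rw [Subgroup.relIndex, hst, MulAction.index_stabilizer]
    have horb : MulAction.orbit (GG d1 d2) q0 =
        (fun (a x : Fin 4 → ZMod 2) => q0 x + BB a x) ''
          ((Finset.univ.filter fun x : Fin 4 → ZMod 2 => q0 x = 0 : Finset _) : Set _) := by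
      ext f
      constructor
      · rintro ⟨⟨R, hR⟩, rfl⟩
        obtain ⟨a, ha0, ha⟩ := orbit_form (S := red2 (R⁻¹).val) (T := red2 R.val)
          (red2_sympl d1 d2 h1 h2 ((GG d1 d2).inv_mem hR))
          (by rw [← red2_mul, R.mul_inv, red2_one]) (by rw [← red2_mul, R.inv_mul, red2_one])
        refine ⟨a, by simpa using ha0, ?_⟩
        funext x
        exact (ha x).symm
      · rintro ⟨a, ha, rfl⟩
        have ha0 : q0 a = 0 := by simpa using ha
        refine ⟨⟨tvU d1 d2 (fun i => ((a i).val : ℤ)), tvU_mem d1 d2 _⟩, ?_⟩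
        funext x
        change ((tvU d1 d2 (fun i => ((a i).val : ℤ))) • q0) x = _
        rw [smul_def, tvU_inv]
        exact q0_tv d1 d2 h1 h2 a x ha0
    rw [horb, Set.ncard_image_of_injective, Set.ncard_coe_finset, zeros_count]
    intro a b hab
    exact BB_inj fun x => add_left_cancel (congrFun hab x)
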